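/- Let L_1 ∈ ℝ^{M×M} and L_2 ∈ ℝ^{N×N} be symmetric matrices such that γ‖V‖_F² ≤ ⟨V, L_1 V + V L_2⟩_F ≤ Γ‖V‖_F² for all V ∈ ℝ^{M×N}, where 0 < γ ≤ Γ. Let B ∈ ℝ^{M×N} and let U be the solution of the Sylvester equation L_1 U + U L_2 = B. Then for every integer n ≥ 1: τ_{n·rank(B)}(U) ≤ ((Γ−γ)/(Γ+γ))^n · ‖U‖_F; i.e., the singular values of the solution of such a Sylvester-type equation decay exponentially with the rank, at rate governed by the condition number κ = Γ/γ. -/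

import Mathlib

open Matrix

/-- Frobenius inner product of real matrices. -/
noncomputable def frobInner {M N : ℕ} (X Y : Matrix (Fin M) (Fin N) ℝ) : ℝ :=
  ∑ i, ∑ j, X i j * Y i j

/-- Frobenius norm of a real matrix. -/
noncomputable def frobNorm {M N : ℕ} (X : Matrix (Fin M) (Fin N) ℝ) : ℝ :=
  Real.sqrt (frobInner X X)

/-- Best rank-`r` approximation error in the Frobenius norm. -/
noncomputable def tau {M N : ℕ} (r : ℕ) (U : Matrix (Fin M) (Fin N) ℝ) : ℝ :=
  sInf {x : ℝ | ∃ V : Matrix (Fin M) (Fin N) ℝ, V.rank ≤ r ∧ x = frobNorm (U - V)}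

theorem frobInner_comm {M N : ℕ} (X Y : Matrix (Fin M) (Fin N) ℝ) :
    frobInner X Y = frobInner Y X := by
  simp only [frobInner, mul_comm]

theorem frobInner_add_left {M N : ℕ} (X Y Z : Matrix (Fin M) (Fin N) ℝ) :
    frobInner (X + Y) Z = frobInner X Z + frobInner Y Z := by
  simp only [frobInner, Matrix.add_apply, add_mul, Finset.sum_add_distrib]

theorem frobInner_smul_left {M N : ℕ} (c : ℝ) (X Y : Matrix (Fin M) (Fin N) ℝ) :
    frobInner (c • X) Y = c * frobInner X Y := by
  simp only [frobInner, Matrix.smul_apply, smul_eq_mul, Finset.mul_sum, mul_assoc]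

theorem frobInner_add_right {M N : ℕ} (X Y Z : Matrix (Fin M) (Fin N) ℝ) :
    frobInner X (Y + Z) = frobInner X Y + frobInner X Z := by
  simp only [frobInner_comm X, frobInner_add_left]

theorem frobInner_smul_right {M N : ℕ} (c : ℝ) (X Y : Matrix (Fin M) (Fin N) ℝ) :
    frobInner X (c • Y) = c * frobInner X Y := by
  simp only [frobInner_comm X, frobInner_smul_left]

theorem frobInner_self_nonneg {M N : ℕ} (X : Matrix (Fin M) (Fin N) ℝ) :
    0 ≤ frobInner X X :=
  Finset.sum_nonneg fun _ _ => Finset.sum_nonneg fun _ _ => mul_self_nonneg _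

theorem frobNorm_sq {M N : ℕ} (X : Matrix (Fin M) (Fin N) ℝ) :
    frobNorm X ^ 2 = frobInner X X :=
  Real.sq_sqrt (frobInner_self_nonneg X)

theorem frobNorm_nonneg {M N : ℕ} (X : Matrix (Fin M) (Fin N) ℝ) : 0 ≤ frobNorm X :=
  Real.sqrt_nonneg _

theorem frobInner_eq_trace {M N : ℕ} (X Y : Matrix (Fin M) (Fin N) ℝ) :
    frobInner X Y = (Xᵀ * Y).trace := by
  simp only [frobInner, Matrix.trace, Matrix.diag_apply, Matrix.mul_apply, Matrix.transpose_apply]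
  exact Finset.sum_comm

theorem frobInner_mul_left {M N : ℕ} (A : Matrix (Fin M) (Fin M) ℝ)
    (X Y : Matrix (Fin M) (Fin N) ℝ) :
    frobInner (A * X) Y = frobInner X (Aᵀ * Y) := by
  simp only [frobInner_eq_trace, Matrix.transpose_mul, Matrix.mul_assoc]

theorem frobInner_mul_right {M N : ℕ} (A : Matrix (Fin N) (Fin N) ℝ)
    (X Y : Matrix (Fin M) (Fin N) ℝ) :
    frobInner (X * A) Y = frobInner X (Y * Aᵀ) := by
  simp only [frobInner_eq_trace, Matrix.transpose_mul, Matrix.mul_assoc]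
  rw [Matrix.trace_mul_comm, Matrix.mul_assoc]

/-- A linear map that is symmetric for the Frobenius inner product and whose quadratic form is
bounded by `ρ` is bounded by `ρ` in the Frobenius norm. -/
theorem frobNorm_le_of_quadratic_form_bound {M N : ℕ}
    (T : Matrix (Fin M) (Fin N) ℝ →ₗ[ℝ] Matrix (Fin M) (Fin N) ℝ)
    (hT : ∀ V W, frobInner (T V) W = frobInner V (T W)) {ρ : ℝ} (hρ : 0 ≤ ρ)
    (hbound : ∀ V, |frobInner V (T V)| ≤ ρ * frobInner V V) (V : Matrix (Fin M) (Fin N) ℝ) :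
    frobNorm (T V) ≤ ρ * frobNorm V := by
  have key (t : ℝ) : 2 * t * frobInner (T V) (T V) ≤
      ρ * (t ^ 2 * frobInner V V + frobInner (T V) (T V)) := by
    have h₁ := (abs_le.mp (hbound (t • V + T V))).2
    have h₂ := (abs_le.mp (hbound (t • V + (-1 : ℝ) • T V))).1
    have h₃ := hT V (T V)
    simp only [map_add, map_smul, frobInner_add_left, frobInner_add_right, frobInner_smul_left,
      frobInner_smul_right, frobInner_comm (T V) V] at h₁ h₂
    rw [← h₃] at h₁ h₂
    linarith
  refine abs_le_of_sq_le_sq' ?_ (mul_nonneg hρ (frobNorm_nonneg V)) |>.2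
  rw [mul_pow, frobNorm_sq, frobNorm_sq]
  rcases hρ.eq_or_lt with rfl | h
  · linarith [key 1]
  · have := key ρ
    refine le_of_mul_le_mul_left ?_ h
    linarith

/-- One step of the Richardson iteration contracts the error. -/
theorem frobNorm_richardson_le {M N : ℕ}
    (L₁ : Matrix (Fin M) (Fin M) ℝ) (L₂ : Matrix (Fin N) (Fin N) ℝ)
    (hL₁ : L₁ᵀ = L₁) (hL₂ : L₂ᵀ = L₂)
    (γ Γ : ℝ) (hγ : 0 < γ) (hγΓ : γ ≤ Γ)
    (hlow : ∀ V : Matrix (Fin M) (Fin N) ℝ,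
      γ * (frobNorm V) ^ 2 ≤ frobInner V (L₁ * V + V * L₂))
    (hup : ∀ V : Matrix (Fin M) (Fin N) ℝ,
      frobInner V (L₁ * V + V * L₂) ≤ Γ * (frobNorm V) ^ 2)
    (V : Matrix (Fin M) (Fin N) ℝ) :
    frobNorm (V + (-(2 / (γ + Γ))) • (L₁ * V + V * L₂)) ≤
      ((Γ - γ) / (Γ + γ)) * frobNorm V := by
  have hpos : 0 < γ + Γ := by linarith
  let T : Matrix (Fin M) (Fin N) ℝ →ₗ[ℝ] Matrix (Fin M) (Fin N) ℝ :=
    { toFun := fun V => V + (-(2 / (γ + Γ))) • (L₁ * V + V * L₂)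
      map_add' := fun X Y => by
        simp only [Matrix.mul_add, Matrix.add_mul, smul_add]
        abel
      map_smul' := fun c X => by
        simp only [Matrix.mul_smul, Matrix.smul_mul, smul_add, RingHom.id_apply,
          smul_comm c (-(2 / (γ + Γ)))] }
  refine frobNorm_le_of_quadratic_form_bound T (fun X Y => ?_)
    (div_nonneg (by linarith) (by linarith)) (fun X => ?_) V
  · simp only [T, LinearMap.coe_mk, AddHom.coe_mk, frobInner_add_left, frobInner_add_right,
      frobInner_smul_left, frobInner_smul_right, frobInner_mul_left, frobInner_mul_right, hL₁, hL₂]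
  · have h₁ := hlow X
    have h₂ := hup X
    rw [frobNorm_sq] at h₁ h₂
    simp only [T, LinearMap.coe_mk, AddHom.coe_mk]
    rw [frobInner_add_right, frobInner_smul_right]
    generalize frobInner X (L₁ * X + X * L₂) = q at *
    have e : frobInner X X + -(2 / (γ + Γ)) * q = ((γ + Γ) * frobInner X X - 2 * q) / (Γ + γ) := by
      rw [add_comm Γ γ]
      field_simp
      ring
    rw [e, div_mul_eq_mul_div, abs_div, abs_of_pos (by linarith : 0 < Γ + γ)]
    refine div_le_div_of_nonneg_right (abs_le.mpr ⟨?_, ?_⟩) (by linarith) <;> linarith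

theorem matrix_rank_add_le {M N : ℕ} (X Y : Matrix (Fin M) (Fin N) ℝ) :
    (X + Y).rank ≤ X.rank + Y.rank := by
  unfold Matrix.rank
  rw [Matrix.mulVecLin_add]
  exact (Submodule.finrank_mono (LinearMap.range_add_le _ _)).trans
    (Submodule.finrank_add_le_finrank_add_finrank _ _)

theorem rank_sum_mul_mul_le {M N : ℕ} (A : ℕ → Matrix (Fin M) (Fin M) ℝ)
    (B : Matrix (Fin M) (Fin N) ℝ) (C : ℕ → Matrix (Fin N) (Fin N) ℝ) (n : ℕ) :
    (∑ i ∈ Finset.range n, A i * B * C i).rank ≤ n * B.rank := by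
  induction n with
  | zero => simp
  | succ n ih =>
    rw [Finset.sum_range_succ, Nat.succ_mul]
    exact (matrix_rank_add_le _ _).trans
      (add_le_add ih ((Matrix.rank_mul_le_left _ _).trans (Matrix.rank_mul_le_right _ _)))

/-- A Richardson step raises the length of a left Krylov expansion by one. -/
theorem exists_richardson_eq_sum {M N : ℕ}
    (L₁ : Matrix (Fin M) (Fin M) ℝ) (L₂ : Matrix (Fin N) (Fin N) ℝ)
    (B : Matrix (Fin M) (Fin N) ℝ) (a : ℝ) (C : ℕ → Matrix (Fin N) (Fin N) ℝ) (n : ℕ) :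
    ∃ D : ℕ → Matrix (Fin N) (Fin N) ℝ,
      ∑ i ∈ Finset.range (n + 1), L₁ ^ i * B * D i =
        (∑ i ∈ Finset.range n, L₁ ^ i * B * C i) +
          a • (L₁ * (∑ i ∈ Finset.range n, L₁ ^ i * B * C i) +
            (∑ i ∈ Finset.range n, L₁ ^ i * B * C i) * L₂ - B) := by
  let f : ℕ → Matrix (Fin N) (Fin N) ℝ := fun i => if i < n then C i + a • (C i * L₂) else 0
  let g : ℕ → Matrix (Fin N) (Fin N) ℝ := fun i => if i = 0 then (-a) • 1 else a • C (i - 1)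
  refine ⟨fun i => f i + g i, ?_⟩
  have hf : ∑ i ∈ Finset.range (n + 1), L₁ ^ i * B * f i =
      (∑ i ∈ Finset.range n, L₁ ^ i * B * C i) +
        a • ((∑ i ∈ Finset.range n, L₁ ^ i * B * C i) * L₂) := by
    rw [Finset.sum_range_succ, Matrix.sum_mul, Finset.smul_sum, ← Finset.sum_add_distrib]
    simp only [f, lt_irrefl, if_false, Matrix.mul_zero, add_zero]
    refine Finset.sum_congr rfl fun i hi => ?_
    rw [if_pos (Finset.mem_range.mp hi), Matrix.mul_add, Matrix.mul_smul, Matrix.mul_assoc _ _ L₂]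
  have hg : ∑ i ∈ Finset.range (n + 1), L₁ ^ i * B * g i =
      a • (L₁ * ∑ i ∈ Finset.range n, L₁ ^ i * B * C i) + (-a) • B := by
    rw [Finset.sum_range_succ', Matrix.mul_sum, Finset.smul_sum]
    simp [g, pow_succ', Matrix.mul_assoc]
  simp only [Matrix.mul_add, Finset.sum_add_distrib, hf, hg, smul_add, smul_sub, neg_smul]
  abel

/-- The `n`-th Richardson iterate, as a left Krylov expansion with `n` terms. -/
theorem exists_sum_frobNorm_sub_le {M N : ℕ}
    (L₁ : Matrix (Fin M) (Fin M) ℝ) (L₂ : Matrix (Fin N) (Fin N) ℝ)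
    (hL₁ : L₁ᵀ = L₁) (hL₂ : L₂ᵀ = L₂)
    (γ Γ : ℝ) (hγ : 0 < γ) (hγΓ : γ ≤ Γ)
    (hlow : ∀ V : Matrix (Fin M) (Fin N) ℝ,
      γ * (frobNorm V) ^ 2 ≤ frobInner V (L₁ * V + V * L₂))
    (hup : ∀ V : Matrix (Fin M) (Fin N) ℝ,
      frobInner V (L₁ * V + V * L₂) ≤ Γ * (frobNorm V) ^ 2)
    (U : Matrix (Fin M) (Fin N) ℝ) (n : ℕ) :
    ∃ C : ℕ → Matrix (Fin N) (Fin N) ℝ,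
      frobNorm (U - ∑ i ∈ Finset.range n, L₁ ^ i * (L₁ * U + U * L₂) * C i) ≤
        ((Γ - γ) / (Γ + γ)) ^ n * frobNorm U := by
  induction n with
  | zero => exact ⟨0, by simp⟩
  | succ n ih =>
    obtain ⟨C, hC⟩ := ih
    obtain ⟨D, hD⟩ :=
      exists_richardson_eq_sum L₁ L₂ (L₁ * U + U * L₂) (-(2 / (γ + Γ))) C n
    refine ⟨D, ?_⟩
    rw [hD]
    generalize ∑ i ∈ Finset.range n, L₁ ^ i * (L₁ * U + U * L₂) * C i = V at *
    have e : U - (V + (-(2 / (γ + Γ))) • (L₁ * V + V * L₂ - (L₁ * U + U * L₂))) =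
        (U - V) + (-(2 / (γ + Γ))) • (L₁ * (U - V) + (U - V) * L₂) := by
      simp only [Matrix.mul_sub, Matrix.sub_mul, smul_add, smul_sub]
      abel
    rw [e, pow_succ', mul_assoc]
    exact (frobNorm_richardson_le L₁ L₂ hL₁ hL₂ γ Γ hγ hγΓ hlow hup _).trans
      (mul_le_mul_of_nonneg_left hC (div_nonneg (by linarith) (by linarith)))

theorem tau_le {M N : ℕ} {r : ℕ} (U : Matrix (Fin M) (Fin N) ℝ) {V : Matrix (Fin M) (Fin N) ℝ}
    (hV : V.rank ≤ r) : tau r U ≤ frobNorm (U - V) :=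
  csInf_le ⟨0, by rintro _ ⟨W, -, rfl⟩; exact frobNorm_nonneg _⟩ ⟨V, hV, rfl⟩

/-- exponential singular value decay for the solution of a
coercive Sylvester equation `L₁ U + U L₂ = B` with symmetric coefficients. -/
theorem tau_exponential_decay_sylvester
    {M N : ℕ}
    (L₁ : Matrix (Fin M) (Fin M) ℝ) (L₂ : Matrix (Fin N) (Fin N) ℝ)
    (hL₁ : L₁ᵀ = L₁) (hL₂ : L₂ᵀ = L₂)
    (γ Γ : ℝ) (hγ : 0 < γ) (hγΓ : γ ≤ Γ)
    (hlow : ∀ V : Matrix (Fin M) (Fin N) ℝ,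
      γ * (frobNorm V) ^ 2 ≤ frobInner V (L₁ * V + V * L₂))
    (hup : ∀ V : Matrix (Fin M) (Fin N) ℝ,
      frobInner V (L₁ * V + V * L₂) ≤ Γ * (frobNorm V) ^ 2)
    (B U : Matrix (Fin M) (Fin N) ℝ) (hU : L₁ * U + U * L₂ = B)
    (n : ℕ) (hn : 1 ≤ n) :
    tau (n * B.rank) U ≤ ((Γ - γ) / (Γ + γ)) ^ n * frobNorm U := by
  subst hU
  obtain ⟨C, hC⟩ := exists_sum_frobNorm_sub_le L₁ L₂ hL₁ hL₂ γ Γ hγ hγΓ hlow hup U n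
  exact (tau_le U (rank_sum_mul_mul_le _ _ C n)).trans hC
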